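/- Let [x_k] be a nonsingular Gaussian sequence with positive definite joint covariance matrix C. Then [x_k] is reciprocal if and only if C⁻¹ is cyclic block tri-diagonal, i.e., the d×d blocks of C⁻¹ satisfy (C⁻¹)_{i,j} = 0 for all i, j ∈ [0,N] with 2 ≤ |i − j| ≤ N − 1. -/

import Mathlib

open MeasureTheory ProbabilityTheory

variable {Ω : Type*}

/-- The σ-field generated by the random variables `x k`, `k ∈ S`. -/
noncomputable def sigmaOf [MeasurableSpace Ω] {d : ℕ} (x : ℕ → Ω → (Fin d → ℝ)) (S : Set ℕ) :
    MeasurableSpace Ω :=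
  ⨆ k ∈ S, MeasurableSpace.comap (x k) inferInstance

lemma sigmaOf_le [m : MeasurableSpace Ω] {d : ℕ} {x : ℕ → Ω → (Fin d → ℝ)}
    (hx : ∀ k, Measurable (x k)) (S : Set ℕ) : sigmaOf x S ≤ m :=
  iSup_le fun k => iSup_le fun _ => (hx k).comap_le

/-- `[x_k]` is reciprocal over `[0,N]`: for all `k1 < k2` in `[0,N]`, the σ-fields generated
by `{x_k : k1 < k < k2}` and by `{x_k : k ∈ [0,N], k < k1 or k > k2}` are conditionally
independent given `σ(x_{k1}, x_{k2})`. -/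
def IsReciprocal [MeasurableSpace Ω] [StandardBorelSpace Ω] {d : ℕ} (N : ℕ)
    (P : Measure Ω) [IsFiniteMeasure P]
    (x : ℕ → Ω → (Fin d → ℝ)) (hx : ∀ k, Measurable (x k)) : Prop :=
  ∀ k1 k2, k1 ≤ N → k2 ≤ N → k1 < k2 →
    CondIndep (sigmaOf x {k1, k2})
      (sigmaOf x {k | k1 < k ∧ k < k2})
      (sigmaOf x {k | (k < k1 ∨ k2 < k) ∧ k ≤ N})
      (sigmaOf_le hx _) P

/-- A random vector is (jointly) Gaussian iff every linear functional of it has a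
(possibly degenerate) one-dimensional Gaussian distribution (Cramér–Wold). -/
def IsGaussianVec {ι : Type*} [Fintype ι] [MeasurableSpace Ω]
    (X : Ω → (ι → ℝ)) (P : Measure Ω) : Prop :=
  ∀ a : ι → ℝ, ∃ (mu : ℝ) (v : NNReal),
    Measure.map (fun ω => ∑ i, a i * X ω i) P = gaussianReal mu v

/-- The stacked vector `(x_0', …, x_N')' ∈ ℝ^{(N+1)d}` of the sequence. -/
def stacked {d : ℕ} (N : ℕ) [MeasurableSpace Ω] (x : ℕ → Ω → (Fin d → ℝ)) (ω : Ω) :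
    Fin (N + 1) × Fin d → ℝ :=
  fun p => x p.1 ω p.2

lemma isPiSystem_image2_inter_measurableSet (m₁ m₂ : MeasurableSpace Ω) :
    IsPiSystem (Set.image2 (· ∩ ·) {s | MeasurableSet[m₁] s} {t | MeasurableSet[m₂] t}) := by
  rintro _ ⟨s, hs, t, ht, rfl⟩ _ ⟨s', hs', t', ht', rfl⟩ -
  exact ⟨s ∩ s', @MeasurableSet.inter _ m₁ _ _ hs hs', t ∩ t', @MeasurableSet.inter _ m₂ _ _ ht ht',
    Set.inter_inter_inter_comm ..⟩

lemma generateFrom_image2_inter_measurableSet (m₁ m₂ : MeasurableSpace Ω) :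
    MeasurableSpace.generateFrom
      (Set.image2 (· ∩ ·) {s | MeasurableSet[m₁] s} {t | MeasurableSet[m₂] t}) = m₁ ⊔ m₂ := by
  refine le_antisymm (MeasurableSpace.generateFrom_le ?_) (sup_le ?_ ?_)
  · rintro _ ⟨s, hs, t, ht, rfl⟩
    exact @MeasurableSet.inter _ (m₁ ⊔ m₂) _ _ (le_sup_left (a := m₁) s hs)
      (le_sup_right (b := m₂) t ht)
  · exact fun s hs => MeasurableSpace.measurableSet_generateFrom
      ⟨s, hs, Set.univ, @MeasurableSet.univ _ m₂, Set.inter_univ s⟩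
  · exact fun t ht => MeasurableSpace.measurableSet_generateFrom
      ⟨Set.univ, @MeasurableSet.univ _ m₁, t, ht, Set.univ_inter t⟩

/-- If `mU` is independent of `mZ ⊔ mY`, then, given `mZ`, conditioning events of `mY` does not
interact with events of `mU`. -/
lemma condExp_indicator_inter_of_indep_sup {mU mZ mY : MeasurableSpace Ω} [mΩ : MeasurableSpace Ω]
    {P : Measure Ω} [IsProbabilityMeasure P] (hU : mU ≤ mΩ) (hZ : mZ ≤ mΩ) (hY : mY ≤ mΩ)
    (hind : Indep mU (mZ ⊔ mY) P) {u y : Set Ω} (hu : MeasurableSet[mU] u)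
    (hy : MeasurableSet[mY] y) :
    P⟦u ∩ y | mZ⟧ =ᵐ[P] fun ω => P.real u * (P⟦y | mZ⟧) ω := by
  have hZY : mZ ⊔ mY ≤ mΩ := sup_le hZ hY
  have hint : ∀ {s : Set Ω}, MeasurableSet s → Integrable (s.indicator fun _ => (1 : ℝ)) P :=
    fun hs => (integrable_const 1).indicator hs
  have hmul : ((u ∩ y).indicator fun _ => (1 : ℝ))
      = (y.indicator fun _ => (1 : ℝ)) * (u.indicator fun _ => (1 : ℝ)) := by
    ext ω
    by_cases h1 : ω ∈ u <;> by_cases h2 : ω ∈ y <;> simp [h1, h2]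
  have hinner : P⟦u ∩ y | mZ ⊔ mY⟧ =ᵐ[P] P.real u • (y.indicator fun _ => (1 : ℝ)) := by
    have hyZY : MeasurableSet[mZ ⊔ mY] y := le_sup_right (a := mZ) y hy
    have hpull := condExp_mul_of_stronglyMeasurable_left (μ := P) (m := mZ ⊔ mY)
      (f := y.indicator fun _ => (1 : ℝ)) (g := u.indicator fun _ => (1 : ℝ))
      (stronglyMeasurable_const.indicator hyZY)
      (by rw [← hmul]; exact hint ((hU _ hu).inter (hY _ hy))) (hint (hU _ hu))
    rw [← hmul] at hpull
    have hconst := condExp_indep_eq (μ := P) hU hZY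
      (f := u.indicator fun _ => (1 : ℝ)) (stronglyMeasurable_const.indicator hu) hind
    filter_upwards [hpull, hconst] with ω h1 h2
    rw [h1, Pi.mul_apply, h2, integral_indicator_const _ (hU _ hu)]
    simp [mul_comm]
  calc P⟦u ∩ y | mZ⟧
    _ =ᵐ[P] P[P⟦u ∩ y | mZ ⊔ mY⟧ | mZ] := (condExp_condExp_of_le le_sup_left hZY).symm
    _ =ᵐ[P] P[P.real u • (y.indicator fun _ => (1 : ℝ)) | mZ] := condExp_congr_ae hinner
    _ =ᵐ[P] P.real u • P⟦y | mZ⟧ := condExp_smul _ _ _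
    _ = fun ω => P.real u * (P⟦y | mZ⟧) ω := rfl

/-- If `mU` is independent of `mZ ⊔ mY`, then `mU ⊔ mZ` and `mY` are conditionally independent
given `mZ`. -/
lemma condIndep_sup_of_indep_sup {mU mZ mY : MeasurableSpace Ω} [mΩ : MeasurableSpace Ω]
    [StandardBorelSpace Ω] {P : Measure Ω} [IsProbabilityMeasure P]
    (hU : mU ≤ mΩ) (hZ : mZ ≤ mΩ) (hY : mY ≤ mΩ) (hind : Indep mU (mZ ⊔ mY) P) :
    CondIndep mZ (mU ⊔ mZ) mY hZ P := by
  refine CondIndepSets.condIndep (sup_le hU hZ) hY (isPiSystem_image2_inter_measurableSet mU mZ)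
    (@MeasurableSpace.isPiSystem_measurableSet _ mY)
    (generateFrom_image2_inter_measurableSet mU mZ).symm
    (@MeasurableSpace.generateFrom_measurableSet _ mY).symm ?_
  refine (condIndepSets_iff _ _ _ _ ?_ (fun s hs => hY s hs) _).2 ?_
  · rintro _ ⟨u, hu, z, hz, rfl⟩
    exact (hU u hu).inter (hZ z hz)
  rintro _ y ⟨u, hu, z, hz, rfl⟩ hy
  have hint : ∀ {s : Set Ω}, MeasurableSet s → Integrable (s.indicator fun _ => (1 : ℝ)) P :=
    fun hs => (integrable_const 1).indicator hs
  have hpull : ∀ {s : Set Ω}, MeasurableSet s →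
      P⟦z ∩ s | mZ⟧ =ᵐ[P] (z.indicator fun _ => (1 : ℝ)) * P⟦s | mZ⟧ := by
    intro s hs
    have hmul : ((z ∩ s).indicator fun _ => (1 : ℝ))
        = (z.indicator fun _ => (1 : ℝ)) * (s.indicator fun _ => (1 : ℝ)) := by
      ext ω
      by_cases h1 : ω ∈ z <;> by_cases h2 : ω ∈ s <;> simp [h1, h2]
    have h := condExp_mul_of_stronglyMeasurable_left (μ := P) (m := mZ)
      (f := z.indicator fun _ => (1 : ℝ)) (g := s.indicator fun _ => (1 : ℝ))
      (stronglyMeasurable_const.indicator hz)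
      (by rw [← hmul]; exact hint ((hZ _ hz).inter hs)) (hint hs)
    rwa [← hmul] at h
  have h1 := hpull ((hU u hu).inter (hY y hy))
  have h2 := hpull (hU u hu)
  have h3 := condExp_indicator_inter_of_indep_sup hU hZ hY hind hu hy
  have h4 := condExp_indep_eq (μ := P) hU hZ
      (f := u.indicator fun _ => (1 : ℝ)) (stronglyMeasurable_const.indicator hu)
      (indep_of_indep_of_le_right hind le_sup_left)
  dsimp only
  rw [show u ∩ z ∩ y = z ∩ (u ∩ y) by grind, show u ∩ z = z ∩ u from Set.inter_comm _ _]
  filter_upwards [h1, h2, h3, h4] with ω h1 h2 h3 h4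
  simp only [h1, h2, Pi.mul_apply, h3, h4, integral_indicator_const _ (hU _ hu)]
  simp [mul_assoc]

/-- If `X` and `Y` are conditionally independent given `Z`, then `E[f(X) | Z, Y] = E[f(X) | Z]`. -/
lemma ProbabilityTheory.CondIndepFun.condExp_prodMk_ae_eq {α β γ : Type*} [MeasurableSpace α]
    [MeasurableSpace β] [MeasurableSpace γ] [StandardBorelSpace α] [Nonempty α]
    [StandardBorelSpace β] [Nonempty β] [MeasurableSpace Ω] [StandardBorelSpace Ω] {P : Measure Ω}
    [IsFiniteMeasure P] {X : Ω → α} {Y : Ω → β} {Z : Ω → γ}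
    (hX : Measurable X) (hY : Measurable Y) (hZ : Measurable Z)
    (h : X ⟂ᵢ[Z, hZ; P] Y) {f : α → ℝ} (hf : Measurable f)
    (hint : Integrable (fun ω => f (X ω)) P) :
    P[fun ω => f (X ω) | MeasurableSpace.comap (fun ω => (Z ω, Y ω)) inferInstance]
      =ᵐ[P] P[fun ω => f (X ω) | MeasurableSpace.comap Z inferInstance] := by
  have h' := ae_of_ae_map (hZ.prodMk hY).aemeasurable
    ((condIndepFun_iff_condDistrib_prod_ae_eq_prodMkRight hX hY hZ).1 h.symm)
  filter_upwards [h', condExp_ae_eq_integral_condDistrib (hZ.prodMk hY) hX.aemeasurable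
    hf.stronglyMeasurable hint, condExp_ae_eq_integral_condDistrib hZ hX.aemeasurable
    hf.stronglyMeasurable hint] with ω h1 h2 h3
  rw [h2, h3, h1, Kernel.prodMkRight_apply]

lemma comap_fun_comp_le {β γ : Type*} [MeasurableSpace β] [MeasurableSpace γ] {f : Ω → β}
    {g : β → γ} (hg : Measurable g) :
    MeasurableSpace.comap (fun ω => g (f ω)) inferInstance
      ≤ MeasurableSpace.comap f inferInstance :=
  (hg.comp (comap_measurable f)).comap_le

/-- The coordinate `a` can be regressed on those in `S`: the residual is uncorrelated with each of
them. -/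
lemma Matrix.PosDef.exists_regression {ι : Type*} [Fintype ι] [DecidableEq ι] {C : Matrix ι ι ℝ}
    (hC : C.PosDef) (S : Finset ι) (a : ι) :
    ∃ w : S → ℝ, ∀ t : S, C a t + ∑ s, w s * C s t = 0 := by
  set D : Matrix S S ℝ := C.submatrix Subtype.val Subtype.val
  have hD : IsUnit D.det :=
    (Matrix.isUnit_iff_isUnit_det _).1 (hC.submatrix Subtype.val_injective).isUnit
  refine ⟨-(Matrix.vecMul (fun t : S => C a t) D⁻¹), fun t => ?_⟩
  have h : Matrix.vecMul (Matrix.vecMul (fun t : S => C a t) D⁻¹) D = fun t : S => C a t := by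
    rw [Matrix.vecMul_vecMul, Matrix.nonsing_inv_mul _ hD, Matrix.vecMul_one]
  have ht : ∑ s : S, Matrix.vecMul (fun t : S => C a t) D⁻¹ s * C s t = C a t := congrFun h t
  simp only [Pi.neg_apply, neg_mul, Finset.sum_neg_distrib]
  rw [ht, add_neg_cancel]

/-- If the regressions of the coordinates in `A` on those in `S` leave residuals uncorrelated with
every coordinate outside `A`, then the block of the inverse covariance with rows in `A` and columns
outside `A ∪ S` vanishes. -/
lemma Matrix.inv_apply_eq_zero_of_regression {ι : Type*} [Fintype ι] [DecidableEq ι]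
    {C : Matrix ι ι ℝ} (hC : IsUnit C.det) {A S : Finset ι} (hAS : Disjoint A S) (w : A → S → ℝ)
    (hw : ∀ (a : A) (i : ι), i ∉ A → C a i + ∑ s, w a s * C s i = 0)
    {a b : ι} (ha : a ∈ A) (hbA : b ∉ A) (hbS : b ∉ S) : C⁻¹ a b = 0 := by
  have hinv : ∀ i j, ∑ k, C i k * C⁻¹ k j = (1 : Matrix ι ι ℝ) i j := fun i j => by
    rw [← Matrix.mul_apply, Matrix.mul_nonsing_inv _ hC]
  let M : Matrix A A ℝ := fun a i => C a i + ∑ s, w a s * C s i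
  have key : ∀ (a : A) (j : ι), j ∉ S →
      ∑ i : A, M a i * C⁻¹ i j = (1 : Matrix ι ι ℝ) a j := by
    intro a j hj
    have h1 : ∑ i : A, M a i * C⁻¹ i j
        = ∑ i, (C a i + ∑ s, w a s * C s i) * C⁻¹ i j := by
      rw [Finset.sum_coe_sort A (fun i => (C a i + ∑ s, w a s * C s i) * C⁻¹ i j)]
      refine Finset.sum_subset (Finset.subset_univ _) fun i _ hi => ?_
      rw [hw a i hi, zero_mul]
    rw [h1]
    simp only [add_mul, Finset.sum_add_distrib, hinv, Finset.sum_mul]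
    rw [Finset.sum_comm]
    simp only [mul_assoc, ← Finset.mul_sum, hinv]
    rw [Finset.sum_eq_zero, add_zero]
    intro s _
    rw [Matrix.one_apply_ne (fun h : (s : ι) = j => hj (h ▸ s.2)), mul_zero]
  let Q : Matrix A A ℝ := C⁻¹.submatrix Subtype.val Subtype.val
  have hMQ : M * Q = 1 := by
    ext i j
    refine (key i j (Finset.disjoint_left.1 hAS j.2)).trans ?_
    simp only [Matrix.one_apply, Subtype.ext_iff]
  have hcol : M.mulVec (fun i : A => C⁻¹ i b) = 0 := by
    ext i
    have := key i b hbS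
    rw [Matrix.one_apply_ne (fun h : (i : ι) = b => hbA (h ▸ i.2))] at this
    exact this
  have h0 := congrArg Q.mulVec hcol
  rw [Matrix.mulVec_mulVec, mul_eq_one_comm.1 hMQ, Matrix.one_mulVec, Matrix.mulVec_zero] at h0
  exact congrFun h0 ⟨a, ha⟩

lemma ProbabilityTheory.HasGaussianLaw.covariance_sum_mul {ι : Type*} [Fintype ι]
    [MeasurableSpace Ω] {P : Measure Ω} {X : ι → Ω → ℝ}
    (hG : HasGaussianLaw (fun ω i => X i ω) P) {κ : Type*} [Fintype κ] (e : κ → ι) (c : κ → ℝ)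
    (i : ι) :
    cov[fun ω => ∑ j, c j * X (e j) ω, X i; P] = ∑ j, c j * cov[X (e j), X i; P] := by
  have := hG.isProbabilityMeasure
  rw [covariance_fun_sum_left (fun j => (hG.eval (e j)).memLp_two.const_mul _)
    (hG.eval i).memLp_two]
  simp_rw [covariance_const_mul_left]

section Gaussian

variable {ι : Type*} [Fintype ι] [DecidableEq ι] [mΩ : MeasurableSpace Ω] {P : Measure Ω}
  {X : ι → Ω → ℝ} {C : Matrix ι ι ℝ}

/-- Conditional independence of the coordinates in `A` and in `B` given all the others forces the
`A × B` block of the inverse covariance matrix to vanish. -/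
lemma ProbabilityTheory.HasGaussianLaw.inv_apply_eq_zero_of_condIndepFun [StandardBorelSpace Ω]
    [IsFiniteMeasure P]
    (hG : HasGaussianLaw (fun ω i => X i ω) P) (hX : ∀ i, Measurable (X i))
    (hC : ∀ p q, C p q = cov[X p, X q; P]) (hCpd : C.PosDef) {A B S : Finset ι}
    (hAB : Disjoint A B) (hAS : Disjoint A S) (hBS : Disjoint B S) (hcov : A ∪ B ∪ S = Finset.univ)
    (h : (fun ω (i : A) => X i ω) ⟂ᵢ[fun ω (i : S) => X i ω, (by fun_prop); P]
      (fun ω (i : B) => X i ω)) {a b : ι} (ha : a ∈ A) (hb : b ∈ B) : C⁻¹ a b = 0 := by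
  have := hG.isProbabilityMeasure
  choose w hw using fun a : A => hCpd.exists_regression S a
  refine Matrix.inv_apply_eq_zero_of_regression ((Matrix.isUnit_iff_isUnit_det _).1 hCpd.isUnit)
    hAS w (fun a i hi => ?_) ha (Finset.disjoint_right.1 hAB hb) (Finset.disjoint_left.1 hBS hb)
  by_cases hiS : i ∈ S
  · exact hw a ⟨i, hiS⟩
  have hiB : i ∈ B := by
    have := Finset.mem_univ i
    rw [← hcov] at this
    grind
  set Z : Ω → S → ℝ := fun ω i => X i ω
  set Y : Ω → B → ℝ := fun ω i => X i ω
  have hZ : Measurable Z := by fun_prop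
  have hY : Measurable Y := by fun_prop
  set T : Ω → ℝ := fun ω => ∑ s : S, w a s * X s ω with hT
  set R : Ω → ℝ := X a + T with hR
  have hTmem : MemLp T 2 P := memLp_finsetSum _ fun s _ => (hG.eval s).memLp_two.const_mul _
  have hRmem : MemLp R 2 P := (hG.eval a).memLp_two.add hTmem
  have hRcov : ∀ i, cov[R, X i; P] = C a i + ∑ s, w a s * C s i := fun i => by
    rw [hR, covariance_add_left (hG.eval a).memLp_two hTmem (hG.eval i).memLp_two, hT,
      hG.covariance_sum_mul Subtype.val]
    simp only [hC]
  have hTZ : Measurable[MeasurableSpace.comap Z inferInstance] T := by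
    have : T = (fun z : S → ℝ => ∑ s, w a s * z s) ∘ Z := rfl
    rw [this]
    exact Measurable.comp (by fun_prop) (comap_measurable Z)
  have hRmeas : Measurable R := (hX a).add (by fun_prop)
  have hXint : Integrable (X a) P := (hG.eval a).integrable
  have hXm := h.condExp_prodMk_ae_eq (by fun_prop) hY hZ (f := fun z : A → ℝ => z a)
    (by fun_prop) hXint
  set m := MeasurableSpace.comap (fun ω => (Z ω, Y ω)) inferInstance
  have hmle : m ≤ mΩ := (hZ.prodMk hY).comap_le
  have hZm : MeasurableSpace.comap Z inferInstance ≤ m := by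
    refine Measurable.comap_le ?_
    exact measurable_fst.comp (comap_measurable fun ω => (Z ω, Y ω))
  have hind : IndepFun (fun ω (_ : Unit) => R ω) Z P := by
    refine HasGaussianLaw.indepFun_of_covariance_eval (X := fun (_ : Unit) => R)
      (Y := fun (s : S) => X s) ?_ fun _ s => ?_
    · let L : (ι → ℝ) →ₗ[ℝ] (Unit → ℝ) × (S → ℝ) :=
        { toFun := fun y => (fun _ => y a + ∑ s : S, w a s * y s, fun s => y s)
          map_add' := fun y z => by
            ext <;> simp [mul_add, Finset.sum_add_distrib]; ring
          map_smul' := fun c y => by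
            ext <;> simp [mul_add, Finset.mul_sum, mul_left_comm] }
      exact hG.map_fun L.toContinuousLinearMap
    · rw [hRcov, hw]
  have hRZ : P[R | MeasurableSpace.comap Z inferInstance] =ᵐ[P] fun _ => P[R] :=
    condExp_indep_eq hRmeas.comap_le hZ.comap_le
      (comap_measurable R).stronglyMeasurable
      (hind.comp (measurable_pi_apply ()) measurable_id)
  have hTint : Integrable T P := hTmem.integrable (by norm_num)
  have hTm : Measurable[m] T := hTZ.mono hZm le_rfl
  have hRm : P[R | m] =ᵐ[P] fun _ => P[R] := by
    filter_upwards [condExp_add hXint hTint m, condExp_add hXint hTint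
      (MeasurableSpace.comap Z inferInstance), hXm, hRZ] with ω h1 h2 h3 h4
    rw [← h4, h1, h2, Pi.add_apply, Pi.add_apply, h3,
      condExp_of_stronglyMeasurable hmle hTm.stronglyMeasurable hTint,
      condExp_of_stronglyMeasurable hZ.comap_le hTZ.stronglyMeasurable hTint]
  have hXi : Measurable[m] (X i) :=
    ((measurable_pi_apply (⟨i, hiB⟩ : B)).comp measurable_snd).comp
      (comap_measurable fun ω => (Z ω, Y ω))
  have hRX : Integrable (X i * R) P := (hG.eval i).memLp_two.integrable_mul hRmem
  have hpull := condExp_mul_of_stronglyMeasurable_left (μ := P) hXi.stronglyMeasurable hRX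
    (hRmem.integrable (by norm_num))
  rw [← hRcov, covariance_comm, covariance_eq_sub (hG.eval i).memLp_two hRmem,
    ← integral_condExp hmle (f := X i * R), sub_eq_zero, ← integral_mul_const]
  refine integral_congr_ae ?_
  filter_upwards [hpull, hRm] with ω h1 h2
  rw [h1, Pi.mul_apply, h2]

/-- If the `A × B` block of the inverse covariance matrix vanishes, then the coordinates in `A` and
in `B` are conditionally independent given all the others. -/
lemma ProbabilityTheory.HasGaussianLaw.condIndepFun_of_inv_apply_eq_zero [StandardBorelSpace Ω]
    [IsFiniteMeasure P]
    (hG : HasGaussianLaw (fun ω i => X i ω) P) (hX : ∀ i, Measurable (X i))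
    (hC : ∀ p q, C p q = cov[X p, X q; P]) (hCpd : C.PosDef) {A B S : Finset ι}
    (hAB : Disjoint A B) (hAS : Disjoint A S) (hcov : A ∪ B ∪ S = Finset.univ)
    (h : ∀ a ∈ A, ∀ b ∈ B, C⁻¹ a b = 0) :
    (fun ω (i : A) => X i ω) ⟂ᵢ[fun ω (i : S) => X i ω, (by fun_prop); P]
      (fun ω (i : B) => X i ω) := by
  have := hG.isProbabilityMeasure
  have hdet := (Matrix.isUnit_iff_isUnit_det _).1 hCpd.isUnit
  let W : A → Ω → ℝ := fun a ω => ∑ j, C⁻¹ a j * X j ω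
  have hind : IndepFun (fun ω a => W a ω) (fun ω (i : ↥(B ∪ S)) => X i ω) P := by
    refine HasGaussianLaw.indepFun_of_covariance_eval (X := W)
      (Y := fun (s : ↥(B ∪ S)) => X s) ?_ fun a s => ?_
    · let L : (ι → ℝ) →ₗ[ℝ] (A → ℝ) × (↥(B ∪ S) → ℝ) :=
        { toFun := fun y => (fun a => ∑ j, C⁻¹ a j * y j, fun s => y s)
          map_add' := fun y z => by
            ext <;> simp [mul_add, Finset.sum_add_distrib]
          map_smul' := fun c y => by
            ext <;> simp [Finset.mul_sum, mul_left_comm] }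
      exact hG.map_fun L.toContinuousLinearMap
    · have hne : (a : ι) ≠ s := by
        intro hs
        rcases Finset.mem_union.1 s.2 with h | h
        · exact Finset.disjoint_left.1 hAB a.2 (hs ▸ h)
        · exact Finset.disjoint_left.1 hAS a.2 (hs ▸ h)
      refine (hG.covariance_sum_mul id (C⁻¹ a) s).trans ?_
      simp only [id, ← hC]
      rw [← Matrix.mul_apply, Matrix.nonsing_inv_mul _ hdet, Matrix.one_apply_ne hne]
  have hrec : ∀ a : A, ∃ (c : A → ℝ) (e : S → ℝ),
      ∀ ω, X a ω = ∑ a', c a' * W a' ω + ∑ s, e s * X s ω := by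
    intro a
    let Q : Matrix A A ℝ := C⁻¹.submatrix Subtype.val Subtype.val
    have hQ : IsUnit Q.det :=
      (Matrix.isUnit_iff_isUnit_det _).1 (hCpd.inv.submatrix Subtype.val_injective).isUnit
    refine ⟨Q⁻¹ a, fun s => -∑ a', Q⁻¹ a a' * C⁻¹ a' s, fun ω => ?_⟩
    have hW : ∀ a' : A, W a' ω = ∑ j : A, Q a' j * X j ω + ∑ s : S, C⁻¹ a' s * X s ω := by
      intro a'
      have hsum : ∑ j ∈ A ∪ S, C⁻¹ a' j * X j ω = W a' ω := by
        refine Finset.sum_subset (Finset.subset_univ _) fun j _ hj => ?_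
        have hjB : j ∈ B := by
          have := Finset.mem_univ j
          rw [← hcov] at this
          grind
        rw [h a' a'.2 j hjB, zero_mul]
      rw [← hsum, Finset.sum_union hAS, ← Finset.sum_coe_sort A, ← Finset.sum_coe_sort S]
      rfl
    have hQQ : ∑ a', Q⁻¹ a a' * ∑ j : A, Q a' j * X j ω = X a ω := by
      have := congrFun (Matrix.mulVec_mulVec (fun j : A => X j ω) Q⁻¹ Q) a
      rw [Matrix.nonsing_inv_mul _ hQ, Matrix.one_mulVec] at this
      simpa [Matrix.mulVec, dotProduct] using this
    simp only [hW, mul_add, Finset.sum_add_distrib, hQQ, neg_mul, Finset.sum_neg_distrib]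
    simp only [Finset.sum_mul, Finset.mul_sum]
    rw [Finset.sum_comm (s := (Finset.univ : Finset S))]
    simp only [mul_assoc, add_neg_cancel_right]
  have hW : Measurable fun ω a => W a ω := by fun_prop
  have hZ : Measurable fun ω (i : S) => X i ω := by fun_prop
  have hY : Measurable fun ω (i : B) => X i ω := by fun_prop
  refine condIndep_of_condIndep_of_le_left (condIndep_sup_of_indep_sup hW.comap_le hZ.comap_le
    hY.comap_le (indep_of_indep_of_le_right hind (sup_le ?_ ?_))) ?_
  · exact comap_fun_comp_le (f := fun ω (i : ↥(B ∪ S)) => X i ω)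
      (g := fun y (s : S) => y ⟨s, Finset.mem_union_right _ s.2⟩) (by fun_prop)
  · exact comap_fun_comp_le (f := fun ω (i : ↥(B ∪ S)) => X i ω)
      (g := fun y (b : B) => y ⟨b, Finset.mem_union_left _ b.2⟩) (by fun_prop)
  · choose c e hce using hrec
    simp only [hce]
    rw [← MeasurableSpace.comap_prodMk]
    exact comap_fun_comp_le (f := fun ω => (fun a => W a ω, fun i : S => X i ω))
      (g := fun y a => ∑ a', c a a' * y.1 a' + ∑ s, e a s * y.2 s) (by fun_prop)

end Gaussian

lemma sigmaOf_eq_comap_stacked [MeasurableSpace Ω] {N d : ℕ} (x : ℕ → Ω → (Fin d → ℝ)) {T : Set ℕ}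
    (hT : ∀ k ∈ T, k ≤ N) {F : Finset (Fin (N + 1) × Fin d)} (hF : ∀ p, p ∈ F ↔ (p.1 : ℕ) ∈ T) :
    sigmaOf x T = MeasurableSpace.comap (fun ω (p : F) => stacked N x ω p) inferInstance := by
  refine le_antisymm (iSup₂_le fun k hk => ?_) (Measurable.comap_le ?_)
  · exact comap_fun_comp_le (f := fun ω (p : F) => stacked N x ω p)
      (g := fun y a => y ⟨(⟨k, Nat.lt_succ_of_le (hT k hk)⟩, a), (hF _).2 hk⟩) (by fun_prop)
  · refine @measurable_pi_lambda _ _ _ (sigmaOf x T) _ _ fun p => ?_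
    have h : MeasurableSpace.comap (x p.1.1) inferInstance ≤ sigmaOf x T :=
      le_iSup₂_of_le _ ((hF p).1 p.2) le_rfl
    exact ((measurable_pi_apply p.1.2).comp (comap_measurable (x p.1.1))).mono h le_rfl

lemma measurable_stacked [MeasurableSpace Ω] {N d : ℕ} {x : ℕ → Ω → (Fin d → ℝ)}
    (hx : ∀ k, Measurable (x k)) (p : Fin (N + 1) × Fin d) :
    Measurable fun ω => stacked N x ω p :=
  (measurable_pi_apply p.2).comp (hx p.1)

lemma condIndep_sigmaOf_iff [MeasurableSpace Ω] [StandardBorelSpace Ω] {N d : ℕ} {P : Measure Ω}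
    [IsFiniteMeasure P] {x : ℕ → Ω → (Fin d → ℝ)} (hx : ∀ k, Measurable (x k))
    {T U V : Set ℕ} (hT : ∀ k ∈ T, k ≤ N) (hU : ∀ k ∈ U, k ≤ N) (hV : ∀ k ∈ V, k ≤ N)
    {S A B : Finset (Fin (N + 1) × Fin d)} (hS : ∀ p, p ∈ S ↔ (p.1 : ℕ) ∈ T)
    (hA : ∀ p, p ∈ A ↔ (p.1 : ℕ) ∈ U) (hB : ∀ p, p ∈ B ↔ (p.1 : ℕ) ∈ V) :
    CondIndep (sigmaOf x T) (sigmaOf x U) (sigmaOf x V) (sigmaOf_le hx T) P ↔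
      (fun ω (p : A) => stacked N x ω p)
        ⟂ᵢ[fun ω (p : S) => stacked N x ω p,
          (measurable_pi_lambda _ fun p => measurable_stacked hx p.1); P]
        (fun ω (p : B) => stacked N x ω p) := by
  rw [condIndepFun_iff_condIndep]
  simp only [sigmaOf_eq_comap_stacked x hT hS, sigmaOf_eq_comap_stacked x hU hA,
    sigmaOf_eq_comap_stacked x hV hB]

lemma IsGaussianVec.hasGaussianLaw {ι : Type*} [Fintype ι] [MeasurableSpace Ω] {X : Ω → ι → ℝ}
    {P : Measure Ω} (hX : Measurable X) (h : IsGaussianVec X P) : HasGaussianLaw X P := by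
  classical
  refine ⟨isGaussian_of_map_eq_gaussianReal fun L => ?_⟩
  obtain ⟨mu, v, hmv⟩ := h fun i => L (Pi.single i 1)
  refine ⟨mu, v, ?_⟩
  rw [Measure.map_map (by fun_prop) hX, ← hmv]
  congr 1
  ext ω
  have hL : L (X ω) = ∑ i, X ω i • L (Pi.single i 1) := by
    conv_lhs => rw [pi_eq_sum_univ' (X ω), map_sum]
    simp [map_smul]
  simp [hL, mul_comm]

lemma condIndep_sigmaOf_iff_inv_apply_eq_zero [MeasurableSpace Ω] [StandardBorelSpace Ω] {N d : ℕ}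
    {P : Measure Ω} [IsProbabilityMeasure P] {x : ℕ → Ω → (Fin d → ℝ)}
    (hx : ∀ k, Measurable (x k)) (hG : IsGaussianVec (stacked N x) P)
    {C : Matrix (Fin (N + 1) × Fin d) (Fin (N + 1) × Fin d) ℝ}
    (hC : ∀ p q, C p q = cov[fun ω => stacked N x ω p, fun ω => stacked N x ω q; P])
    (hCpd : C.PosDef) {k₁ k₂ : ℕ} (hk₂ : k₂ ≤ N) (hk : k₁ < k₂) :
    CondIndep (sigmaOf x {k₁, k₂}) (sigmaOf x {k | k₁ < k ∧ k < k₂})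
      (sigmaOf x {k | (k < k₁ ∨ k₂ < k) ∧ k ≤ N}) (sigmaOf_le hx _) P ↔
      ∀ p q : Fin (N + 1) × Fin d, (k₁ < p.1 ∧ p.1 < k₂) → (q.1 < k₁ ∨ k₂ < q.1) →
        C⁻¹ p q = 0 := by
  let S : Finset (Fin (N + 1) × Fin d) := {p | (p.1 : ℕ) = k₁ ∨ (p.1 : ℕ) = k₂}
  let A : Finset (Fin (N + 1) × Fin d) := {p | k₁ < (p.1 : ℕ) ∧ (p.1 : ℕ) < k₂}
  let B : Finset (Fin (N + 1) × Fin d) := {p | (p.1 : ℕ) < k₁ ∨ k₂ < (p.1 : ℕ)}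
  have hX := fun p => measurable_stacked (N := N) hx p
  have hG' := hG.hasGaussianLaw (measurable_pi_lambda _ hX)
  have hAB : Disjoint A B := Finset.disjoint_left.2 fun p => by simp [A, B]; omega
  have hAS : Disjoint A S := Finset.disjoint_left.2 fun p => by simp [A, S]; omega
  have hBS : Disjoint B S := Finset.disjoint_left.2 fun p => by simp [B, S]; omega
  have hABS : A ∪ B ∪ S = Finset.univ := by ext p; simp [A, B, S]; omega
  rw [condIndep_sigmaOf_iff (S := S) (A := A) (B := B) hx (by grind) (by grind) (by grind)
    (by simp [S]) (by simp [A]) (by simp [B]; omega)]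
  refine ⟨fun h p q hp hq => ?_, fun h => ?_⟩
  · exact hG'.inv_apply_eq_zero_of_condIndepFun hX hC hCpd hAB hAS hBS hABS h
      (by simpa [A] using hp) (by simpa [B] using hq)
  · exact hG'.condIndepFun_of_inv_apply_eq_zero hX hC hCpd hAB hAS hABS fun p hp q hq =>
      h p q (by simpa [A] using hp) (by simpa [B] using hq)


/-- a nonsingular Gaussian sequence with covariance matrix `C` is reciprocal
iff `C⁻¹` is cyclic block tri-diagonal: its `d × d` blocks `(C⁻¹)_{i,j}` vanish whenever
`2 ≤ |i − j| ≤ N − 1`. -/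
theorem stmt_12 [MeasurableSpace Ω] [StandardBorelSpace Ω]
    (N d : ℕ) (hN : 2 ≤ N) (hd : 1 ≤ d)
    (P : Measure Ω) [IsProbabilityMeasure P]
    (x : ℕ → Ω → (Fin d → ℝ)) (hx : ∀ k, Measurable (x k))
    (hG : IsGaussianVec (stacked N x) P)
    (C : Matrix (Fin (N + 1) × Fin d) (Fin (N + 1) × Fin d) ℝ)
    (hC : ∀ p q, C p q = ∫ ω, (x p.1 ω p.2 - ∫ ω', x p.1 ω' p.2 ∂P) *
      (x q.1 ω q.2 - ∫ ω', x q.1 ω' q.2 ∂P) ∂P)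
    (hCpd : C.PosDef) :
    IsReciprocal N P x hx ↔
      ∀ i, ∀ hi : i ≤ N, ∀ j, ∀ hj : j ≤ N,
        ((i + 2 ≤ j ∧ j < i + N) ∨ (j + 2 ≤ i ∧ i < j + N)) →
        ∀ a b, C⁻¹ (⟨i, by omega⟩, a) (⟨j, by omega⟩, b) = 0 := by
  have key := fun k₁ k₂ (h₂ : k₂ ≤ N) (h : k₁ < k₂) =>
    condIndep_sigmaOf_iff_inv_apply_eq_zero hx hG hC hCpd h₂ h
  have hsymm : ∀ p q, C⁻¹ p q = 0 → C⁻¹ q p = 0 := fun p q h => by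
    rw [← hCpd.inv.isHermitian.apply, h, star_zero]
  refine ⟨fun h => ?_, fun h k₁ k₂ h₁ h₂ h₁₂ => (key k₁ k₂ h₂ h₁₂).2 fun p q hp hq => ?_⟩
  · have hlt : ∀ i j (hi : i ≤ N) (hj : j ≤ N), i + 2 ≤ j → j < i + N → ∀ a b,
        C⁻¹ (⟨i, Nat.lt_succ_of_le hi⟩, a) (⟨j, Nat.lt_succ_of_le hj⟩, b) = 0 := by
      intro i j hi hj hij hji a b
      by_cases hi0 : i = 0
      · exact hsymm _ _ ((key (j - 1) (j + 1) (by omega) (by omega)).1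
          (h _ _ (by omega) (by omega) (by omega)) _ _ (by dsimp only; omega)
          (by dsimp only; omega))
      · exact (key (i - 1) (i + 1) (by omega) (by omega)).1
          (h _ _ (by omega) (by omega) (by omega)) _ _ (by dsimp only; omega)
          (by dsimp only; omega)
    rintro i hi j hj (⟨hij, hji⟩ | ⟨hij, hji⟩) a b
    · exact hlt i j hi hj hij hji a b
    · exact hsymm _ _ (hlt j i hj hi hij hji b a)
  · exact h p.1 (by omega) q.1 (by omega) (by omega) p.2 q.2
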